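/- arXiv:2308.04837 — 5 statements merged into one kernel-verified Lean document; each statement's English description precedes it below -/
import Mathlib

section
/- Let n ≥ 1 and let β_1, …, β_m be the rows of an m × n Florentine array over Z_n. Then for any two distinct row indices i ≠ j and any l ∈ Z_n, the set N^l_{(i,j)} = { t ∈ Z_n : β_i(t) = β_j((t + l) mod n) } has at most 2 elements. -/
/-- `β` is an `m × n` Florentine array over `Z_n`: each row `β k` (restricted to
positions `0, …, n-1`) is a permutation of the symbols `{0, …, n-1}`, and there are no
indices `i ≠ j` and integers `s, s', d` with `d ≥ 1`, `s + d ≤ n-1`, `s' + d ≤ n-1`,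
`β i s = β j s'` and `β i (s+d) = β j (s'+d)`. -/
def IsFlorentine (n m : ℕ) (β : Fin m → ℕ → ℕ) : Prop :=
  (∀ k : Fin m, Set.BijOn (β k) (Set.Iio n) (Set.Iio n)) ∧
  ∀ i j : Fin m, i ≠ j → ∀ s s' d : ℕ, 1 ≤ d → s + d ≤ n - 1 → s' + d ≤ n - 1 →
    ¬(β i s = β j s' ∧ β i (s + d) = β j (s' + d))

/-- Two coincidences between distinct rows of a Florentine array whose positions differ by the
same amount in both rows are equal. -/
theorem IsFlorentine.eq_of_coincidences {n m : ℕ} {β : Fin m → ℕ → ℕ} (hβ : IsFlorentine n m β)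
    {i j : Fin m} (hij : i ≠ j) {s t s' t' : ℕ} (hs : s < n) (ht : t < n) (hs' : s' < n)
    (ht' : t' < n) (h : s + t' = t + s') (hss' : β i s = β j s') (htt' : β i t = β j t') :
    s = t := by
  wlog hst : s ≤ t generalizing s t s' t'
  · exact (this ht hs ht' hs' h.symm htt' hss' (by omega)).symm
  by_contra hne
  obtain ⟨d, rfl⟩ := Nat.exists_eq_add_of_le hst
  obtain rfl : t' = s' + d := by omega
  exact hβ.2 i j hij s s' d (by omega) (by omega) (by omega) ⟨hss', htt'⟩

/-- For any two distinct rows `i ≠ j` of an `m × n` Florentine array over `Z_n` and any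
`l ∈ Z_n`, the set `N^l_{(i,j)} = { t ∈ Z_n : β i t = β j ((t + l) mod n) }` has at most
two elements. -/
theorem florentine_coincidence_set_card_le_two
    (n m : ℕ) (hn : 1 ≤ n) (β : Fin m → ℕ → ℕ) (hβ : IsFlorentine n m β)
    (i j : Fin m) (hij : i ≠ j) (l : ℕ) (hl : l < n) :
    {t : ℕ | t < n ∧ β i t = β j ((t + l) % n)}.ncard ≤ 2 := by
  have hwrap : ∀ t, t < n → ¬ t + l < n → (t + l) % n = t + l - n := fun t ht h => by
    rw [Nat.mod_eq_sub_mod (by omega), Nat.mod_eq_of_lt (by omega)]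
  have hinj : Set.InjOn (fun t => decide (t + l < n))
      {t : ℕ | t < n ∧ β i t = β j ((t + l) % n)} := by
    rintro s ⟨hs, hs'⟩ t ⟨ht, ht'⟩ hst
    refine hβ.eq_of_coincidences hij hs ht (Nat.mod_lt _ hn) (Nat.mod_lt _ hn) ?_ hs' ht'
    have hst : s + l < n ↔ t + l < n := by simpa using hst
    by_cases h : s + l < n
    · rw [Nat.mod_eq_of_lt h, Nat.mod_eq_of_lt (hst.1 h)]
      omega
    · rw [hwrap s hs h, hwrap t ht (mt hst.2 h)]
      omega
  calc _ ≤ (Set.univ : Set Bool).ncard :=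
        Set.ncard_le_ncard_of_injOn _ (fun _ _ => Set.mem_univ _) hinj
    _ = 2 := by simp
end

section
/- Let n ≥ 1 and let β_1, …, β_m be the rows of an m × n Florentine array over Z_n. Fix i ≠ j and l with 0 ≤ l < n, and suppose t and t' are two distinct integers with 0 ≤ t, t' < n such that β_i(t) = β_j((t + l) mod n) and β_i(t') = β_j((t' + l) mod n). Then exactly one of t + l and t' + l wraps around modulo n, i.e., the conditions t + l ≥ n and t' + l ≥ n have different truth values. -/
/-- Two coincidences of rows `i ≠ j` at shift `l`, in positions `a < b`, cannot both wrap around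
or both stay below `n`. -/
theorem IsFlorentine.not_wraparound_iff {n m : ℕ} {β : Fin m → ℕ → ℕ} (hβ : IsFlorentine n m β)
    {i j : Fin m} (hij : i ≠ j) {l a b : ℕ} (hl : l < n) (hb : b < n) (hab : a < b)
    (h1 : β i a = β j ((a + l) % n)) (h2 : β i b = β j ((b + l) % n)) :
    ¬(n ≤ a + l ↔ n ≤ b + l) := by
  intro h
  have hlt : (b + l) % n < n := Nat.mod_lt _ (by omega)
  have hmod : (b + l) % n = (a + l) % n + (b - a) := by
    rw [Nat.add_mod_eq_ite, Nat.add_mod_eq_ite, Nat.mod_eq_of_lt hl, Nat.mod_eq_of_lt hb,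
      Nat.mod_eq_of_lt (hab.trans hb)]
    split_ifs <;> omega
  refine hβ.2 i j hij a ((a + l) % n) (b - a) (by omega) (by omega) (by omega) ⟨h1, ?_⟩
  rw [← hmod, Nat.add_sub_cancel' hab.le, h2]

/-- If `t ≠ t'` both satisfy `β i t = β j ((t + l) mod n)` for two distinct rows
`i ≠ j` of an `m × n` Florentine array over `Z_n`, then exactly one of `t + l` and
`t' + l` wraps around modulo `n`. -/
theorem florentine_wraparound_differs
    (n m : ℕ) (hn : 1 ≤ n) (β : Fin m → ℕ → ℕ) (hβ : IsFlorentine n m β)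
    (i j : Fin m) (hij : i ≠ j) (l t t' : ℕ) (hl : l < n) (ht : t < n) (ht' : t' < n)
    (htt' : t ≠ t')
    (h1 : β i t = β j ((t + l) % n)) (h2 : β i t' = β j ((t' + l) % n)) :
    (n ≤ t + l) ↔ ¬ (n ≤ t' + l) := by
  rcases htt'.lt_or_gt with h | h
  · have := hβ.not_wraparound_iff hij hl ht' h h1 h2
    tauto
  · have := hβ.not_wraparound_iff hij hl ht h h2 h1
    tauto
end

section
/- Let N ≥ 1 be an integer, let π be a permutation of Z_N, and let σ be an arbitrary function from Z_N to Z_{N²}. Define the sequence s of period N² by s(t) = exp(2πi · (N · t₂ · π(t₁) + σ(t₁)) / N²), where t = t₁ + N · t₂ with 0 ≤ t₁, t₂ < N. Then s is a perfect sequence: for every τ with 0 < τ < N², the autocorrelation Σ_{t=0}^{N²−1} s((t+τ) mod N²) · conj(s(t)) equals 0. -/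
open Complex in
/-- The generalised Frank sequence of period `N²` determined by a row function
`β : ℕ → ℕ` (a permutation of `Z_N` on `{0, …, N-1}`) and an arbitrary function
`σ : Z_N → Z_{N²}`:  `s(t) = exp(2πi (N t₂ β(t₁) + σ(t₁)) / N²)` where
`t = t₁ + N t₂`, i.e. `t₁ = t % N` and `t₂ = (t / N) % N`. -/
noncomputable def frankSeq (N : ℕ) (β : ℕ → ℕ) (σ : ZMod N → ZMod (N ^ 2)) (t : ℕ) : ℂ :=
  Complex.exp (2 * Real.pi * Complex.I *
    (((N * (t / N % N) * β (t % N) + (σ ((t % N : ℕ) : ZMod N)).val : ℕ) : ℂ) / ((N : ℂ) ^ 2)))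

theorem sum_range_mul_eq_sum_sum {M : Type*} [AddCommMonoid M] (m n : ℕ) (f : ℕ → M) :
    ∑ t ∈ Finset.range (m * n), f t =
      ∑ a ∈ Finset.range n, ∑ b ∈ Finset.range m, f (a + n * b) := by
  rw [Finset.sum_comm, Finset.sum_range, ← finProdFinEquiv.sum_comp, Fintype.sum_prod_type,
    Finset.sum_range]
  refine Finset.sum_congr rfl fun b _ => ?_
  rw [Finset.sum_range]
  rfl

theorem geom_sum_eq_zero_of_pow_eq_one {K : Type*} [Field K] {w : K} {n : ℕ}
    (hw : w ^ n = 1) (hw1 : w ≠ 1) : ∑ b ∈ Finset.range n, w ^ b = 0 := by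
  rw [geom_sum_eq hw1, hw, sub_self, zero_div]

theorem IsPrimitiveRoot.mul_conj_eq_one {ζ : ℂ} {n : ℕ} (hζ : IsPrimitiveRoot ζ n)
    (hn : n ≠ 0) : ζ * (starRingEnd ℂ) ζ = 1 := by
  rw [Complex.mul_conj, Complex.normSq_eq_norm_sq, hζ.norm'_eq_one hn]
  simp

theorem IsPrimitiveRoot.geom_sum_pow_mul_conj_pow {ζ : ℂ} {n x y : ℕ}
    (hζ : IsPrimitiveRoot ζ n) (hx : x < n) (hy : y < n) (hxy : x ≠ y) :
    ∑ b ∈ Finset.range n, (ζ ^ x * (starRingEnd ℂ) ζ ^ y) ^ b = 0 := by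
  have hc := hζ.mul_conj_eq_one (by omega)
  apply geom_sum_eq_zero_of_pow_eq_one
  · rw [mul_pow, pow_right_comm, hζ.pow_eq_one, pow_right_comm, ← map_pow, hζ.pow_eq_one]
    simp
  · intro h
    refine hxy (hζ.pow_inj hx hy ?_)
    calc ζ ^ x = ζ ^ x * (ζ * (starRingEnd ℂ) ζ) ^ y := by rw [hc, one_pow, mul_one]
      _ = ζ ^ x * (starRingEnd ℂ) ζ ^ y * ζ ^ y := by rw [mul_pow]; ring
      _ = ζ ^ y := by rw [h, one_mul]

theorem frankSeq_eq_pow_mul {N : ℕ} (hN : N ≠ 0) (β : ℕ → ℕ) (σ : ZMod N → ZMod (N ^ 2))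
    (t : ℕ) :
    frankSeq N β σ t = Complex.exp (2 * Real.pi * Complex.I / N) ^ (t / N * β (t % N)) *
      Complex.exp (2 * Real.pi * Complex.I *
        (((σ ((t % N : ℕ) : ZMod N)).val : ℂ) / (N : ℂ) ^ 2)) := by
  have hζ := (Complex.isPrimitiveRoot_exp N hN).pow_eq_one
  have hmod : Complex.exp (2 * Real.pi * Complex.I / N) ^ (t / N) =
      Complex.exp (2 * Real.pi * Complex.I / N) ^ (t / N % N) := pow_eq_pow_mod _ hζ
  have hN' : (N : ℂ) ≠ 0 := Nat.cast_ne_zero.mpr hN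
  rw [pow_mul, hmod, ← pow_mul, ← Complex.exp_nat_mul, ← Complex.exp_add, frankSeq]
  congr 1
  generalize t / N % N = q
  push_cast
  field_simp

theorem frankSeq_add_mul {N : ℕ} (hN : N ≠ 0) (β : ℕ → ℕ) (σ : ZMod N → ZMod (N ^ 2))
    (t b : ℕ) :
    frankSeq N β σ (t + N * b) = frankSeq N β σ t *
      (Complex.exp (2 * Real.pi * Complex.I / N) ^ β (t % N)) ^ b := by
  rw [frankSeq_eq_pow_mul hN, frankSeq_eq_pow_mul hN, Nat.add_mul_mod_self_left,
    Nat.add_mul_div_left _ _ (Nat.pos_of_ne_zero hN)]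
  ring

theorem frankSeq_mod_sq {N : ℕ} (β : ℕ → ℕ) (σ : ZMod N → ZMod (N ^ 2)) (t : ℕ) :
    frankSeq N β σ (t % N ^ 2) = frankSeq N β σ t := by
  have h1 : t % N ^ 2 % N = t % N := Nat.mod_mod_of_dvd _ (Dvd.intro_left _ (sq N).symm)
  have h2 : t % N ^ 2 / N % N = t / N % N := by
    rw [sq, Nat.mod_mul_right_div_self, Nat.mod_mod]
  simp only [frankSeq, h1, h2]

theorem frankSeq_mul_conj {N : ℕ} (β : ℕ → ℕ) (σ : ZMod N → ZMod (N ^ 2)) (t : ℕ) :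
    frankSeq N β σ t * (starRingEnd ℂ) (frankSeq N β σ t) = 1 := by
  have h : ‖frankSeq N β σ t‖ = 1 := by
    rw [frankSeq, Complex.norm_exp, Real.exp_eq_one_iff]
    have : (2 * Real.pi * Complex.I *
        (((N * (t / N % N) * β (t % N) + (σ ((t % N : ℕ) : ZMod N)).val : ℕ) : ℂ) /
          ((N : ℂ) ^ 2))) =
        ((2 * Real.pi * (((N * (t / N % N) * β (t % N) +
          (σ ((t % N : ℕ) : ZMod N)).val : ℕ) : ℝ) / ((N : ℝ) ^ 2)) : ℝ) : ℂ) * Complex.I := by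
      generalize N * (t / N % N) * β (t % N) + (σ ((t % N : ℕ) : ZMod N)).val = q
      push_cast
      ring
    rw [this, Complex.re_ofReal_mul, Complex.I_re, mul_zero]
  rw [Complex.mul_conj, Complex.normSq_eq_norm_sq, h]
  simp

/-- (Generalised Frank sequences are perfect.)  For `N ≥ 1`, a permutation `π` of
`Z_N` and an arbitrary `σ : Z_N → Z_{N²}`, the sequence
`s(t) = exp(2πi (N t₂ π(t₁) + σ(t₁)) / N²)`, `t = t₁ + N t₂`, has zero out-of-phase
periodic autocorrelation:  for every `0 < τ < N²`,
`∑_{t=0}^{N²-1} s((t+τ) mod N²) conj(s t) = 0`. -/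
theorem frankSeq_perfect (N : ℕ) (hN : 1 ≤ N)
    (π : ℕ → ℕ) (hπ : Set.BijOn π (Set.Iio N) (Set.Iio N))
    (σ : ZMod N → ZMod (N ^ 2)) (τ : ℕ) (hτ0 : 0 < τ) (hτ : τ < N ^ 2) :
    ∑ t ∈ Finset.range (N ^ 2),
      frankSeq N π σ ((t + τ) % N ^ 2) * (starRingEnd ℂ) (frankSeq N π σ t) = 0 := by
  have hN0 : N ≠ 0 := by omega
  set ζ := Complex.exp (2 * Real.pi * Complex.I / N) with hζ_def
  have hζ : IsPrimitiveRoot ζ N := Complex.isPrimitiveRoot_exp N hN0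
  have hterm : ∀ a ∈ Finset.range N, ∀ b,
      frankSeq N π σ ((a + N * b + τ) % N ^ 2) *
        (starRingEnd ℂ) (frankSeq N π σ (a + N * b)) =
      frankSeq N π σ (a + τ) * (starRingEnd ℂ) (frankSeq N π σ a) *
        (ζ ^ π ((a + τ) % N) * (starRingEnd ℂ) ζ ^ π a) ^ b := by
    intro a ha b
    rw [frankSeq_mod_sq, add_right_comm, frankSeq_add_mul hN0, frankSeq_add_mul hN0,
      Nat.mod_eq_of_lt (Finset.mem_range.mp ha), ← hζ_def]
    simp only [map_mul, map_pow]
    ring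
  rw [show Finset.range (N ^ 2) = Finset.range (N * N) by rw [sq], sum_range_mul_eq_sum_sum,
    Finset.sum_congr rfl fun a ha => Finset.sum_congr rfl fun b _ => hterm a ha b]
  simp only [← Finset.mul_sum]
  by_cases hdvd : N ∣ τ
  · obtain ⟨k, rfl⟩ := hdvd
    have hk0 : k ≠ 0 := by rintro rfl; simp at hτ0
    have hkN : k < N := by rw [sq] at hτ; exact Nat.lt_of_mul_lt_mul_left hτ
    have hrow : ∀ a ∈ Finset.range N,
        frankSeq N π σ (a + N * k) * (starRingEnd ℂ) (frankSeq N π σ a) *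
          ∑ b ∈ Finset.range N, (ζ ^ π ((a + N * k) % N) * (starRingEnd ℂ) ζ ^ π a) ^ b =
        (ζ ^ k) ^ π a * N := by
      intro a ha
      rw [Nat.add_mul_mod_self_left, frankSeq_add_mul hN0,
        Nat.mod_eq_of_lt (Finset.mem_range.mp ha), ← mul_pow, hζ.mul_conj_eq_one hN0,
        mul_right_comm (frankSeq N π σ a), frankSeq_mul_conj, pow_right_comm]
      simp [hζ_def]
    rw [Finset.sum_congr rfl hrow, ← Finset.sum_mul]
    have hperm : ∑ a ∈ Finset.range N, (ζ ^ k) ^ π a = ∑ j ∈ Finset.range N, (ζ ^ k) ^ j := by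
      refine Finset.sum_nbij π ?_ ?_ ?_ fun _ _ => rfl
      · intro a ha
        exact Finset.mem_range.mpr (hπ.mapsTo (Finset.mem_range.mp ha))
      · rw [Finset.coe_range]; exact hπ.injOn
      · rw [Finset.coe_range]; exact hπ.surjOn
    rw [hperm, geom_sum_eq_zero_of_pow_eq_one (by rw [pow_right_comm, hζ.pow_eq_one, one_pow])
      (hζ.pow_ne_one_of_pos_of_lt hk0 hkN), zero_mul]
  · refine Finset.sum_eq_zero fun a ha => ?_
    have haN : a < N := Finset.mem_range.mp ha
    have hsN : (a + τ) % N < N := Nat.mod_lt _ hN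
    have hne : (a + τ) % N ≠ a := by
      intro h
      have h' : a + τ ≡ a + 0 [MOD N] := by
        rw [Nat.ModEq, h, add_zero, Nat.mod_eq_of_lt haN]
      exact hdvd ((Nat.modEq_zero_iff_dvd).mp (Nat.ModEq.add_left_cancel' a h'))
    rw [hζ.geom_sum_pow_mul_conj_pow (hπ.mapsTo hsN) (hπ.mapsTo haN)
      fun h => hne (hπ.injOn hsN haN h), mul_zero]
end

section
/- Let n ≥ 1 and m ≥ 1. If there exists an m × (n+1) circular Florentine array over Z_{n+1}, then there exists an m × n Florentine array over Z_n. (Deleting any one fixed symbol from each row of the circular array yields the required rows.) -/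
/-- `β` is an `m × n` circular Florentine array over `Z_n`: each row is a permutation
of `{0, …, n-1}`, and for all `i ≠ j`, all `l` with `0 < l < n` and all positions
`s, s' < n`, one cannot have both `β i s = β j s'` and
`β i ((s+l) mod n) = β j ((s'+l) mod n)`. -/
def IsCircFlorentine (n m : ℕ) (β : Fin m → ℕ → ℕ) : Prop :=
  (∀ k : Fin m, Set.BijOn (β k) (Set.Iio n) (Set.Iio n)) ∧
  ∀ i j : Fin m, i ≠ j → ∀ l : ℕ, 0 < l → l < n → ∀ s s' : ℕ, s < n → s' < n →
    ¬(β i s = β j s' ∧ β i ((s + l) % n) = β j ((s' + l) % n))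

theorem mod_eq_ite_of_lt_two_mul {a N : ℕ} (h : a < 2 * N) :
    a % N = if a < N then a else a - N := by
  split_ifs with h'
  · exact Nat.mod_eq_of_lt h'
  · rw [Nat.mod_eq_sub_mod (by omega), Nat.mod_eq_of_lt (by omega)]

/-- Rotating a permutation of `{0, …, n}` so that it starts right after the symbol `n` and
dropping that symbol gives a permutation of `{0, …, n-1}`. -/
theorem bijOn_rotate_of_apply_eq {n p : ℕ} {f : ℕ → ℕ}
    (hf : Set.BijOn f (Set.Iio (n + 1)) (Set.Iio (n + 1))) (hp : p < n + 1) (hfp : f p = n) :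
    Set.BijOn (fun s => f ((p + 1 + s) % (n + 1))) (Set.Iio n) (Set.Iio n) := by
  have hlt (s : ℕ) : (p + 1 + s) % (n + 1) < n + 1 := Nat.mod_lt _ n.succ_pos
  have hmod (s : ℕ) (hs : s < n) :
      (p + 1 + s) % (n + 1) = if p + 1 + s < n + 1 then p + 1 + s else p + 1 + s - (n + 1) :=
    mod_eq_ite_of_lt_two_mul (by omega)
  refine ⟨fun s hs => ?_, fun s hs t ht hst => ?_, fun y hy => ?_⟩
  · have hs : s < n := hs
    have h_lt : f ((p + 1 + s) % (n + 1)) < n + 1 := hf.mapsTo (hlt s)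
    have hne : f ((p + 1 + s) % (n + 1)) ≠ n := fun h => by
      have h := hf.injOn (hlt s) hp (h.trans hfp.symm)
      rw [hmod s hs] at h
      split_ifs at h <;> omega
    exact lt_of_le_of_ne (Nat.lt_succ_iff.mp h_lt) hne
  · have hs : s < n := hs
    have ht : t < n := ht
    have h := hf.injOn (hlt s) (hlt t) hst
    rw [hmod s hs, hmod t ht] at h
    split_ifs at h <;> omega
  · have hy : y < n := hy
    obtain ⟨q, hq, rfl⟩ := hf.surjOn (show y < n + 1 by omega)
    have hq : q < n + 1 := hq
    have hqp : q ≠ p := by rintro rfl; omega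
    have hs : (if p < q then q - p - 1 else q + n - p) < n := by split_ifs <;> omega
    refine ⟨_, hs, congrArg f ?_⟩
    rw [hmod _ hs]
    split_ifs <;> omega

/-- If there exists an `m × (n+1)` circular Florentine array over `Z_{n+1}`, then there
exists an `m × n` Florentine array over `Z_n`. -/
theorem florentine_of_circFlorentine (n m : ℕ) (hn : 1 ≤ n) (hm : 1 ≤ m)
    (h : ∃ β : Fin m → ℕ → ℕ, IsCircFlorentine (n + 1) m β) :
    ∃ γ : Fin m → ℕ → ℕ, IsFlorentine n m γ := by
  obtain ⟨β, hbij, hcirc⟩ := h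
  choose p hp hpn using fun k => (hbij k).surjOn (show n < n + 1 by omega)
  refine ⟨fun k s => β k ((p k + 1 + s) % (n + 1)),
    fun k => bijOn_rotate_of_apply_eq (hbij k) (hp k) (hpn k), ?_⟩
  rintro i j hij s s' d hd hs hs' ⟨h₁, h₂⟩
  refine hcirc i j hij d hd (by omega) _ _ (Nat.mod_lt _ n.succ_pos)
    (Nat.mod_lt _ n.succ_pos) ⟨h₁, ?_⟩
  simpa only [Nat.mod_add_mod, add_assoc] using h₂
end

section
/- Let p be a prime. For each a with 1 ≤ a ≤ p−1, let β_a be the permutation of Z_p given by β_a(t) = a·t mod p. Then β_1, …, β_{p−1} form a (p−1) × p circular Florentine array over Z_p; in particular F_c(p) ≥ p−1. -/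
/-- `Fc n` is the maximum `m` such that an `m × n` circular Florentine array exists. -/
noncomputable def Fc (n : ℕ) : ℕ :=
  sSup {m : ℕ | ∃ β : Fin m → ℕ → ℕ, IsCircFlorentine n m β}

theorem IsCircFlorentine.le {n m : ℕ} (hn : 1 < n) {β : Fin m → ℕ → ℕ}
    (h : IsCircFlorentine n m β) : m ≤ n := by
  have hzero : ∀ k, ∃ s, s < n ∧ β k s = 0 := fun k => by
    obtain ⟨s, hs, hs0⟩ := (h.1 k).surjOn (show 0 ∈ Set.Iio n from Nat.zero_lt_of_lt hn)
    exact ⟨s, hs, hs0⟩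
  choose s hs hs0 using hzero
  let next : Fin m → Fin n := fun k =>
    ⟨β k ((s k + 1) % n), (h.1 k).mapsTo (Nat.mod_lt _ (Nat.zero_lt_of_lt hn))⟩
  have hinj : Function.Injective next := fun i j hij => by
    by_contra hne
    exact h.2 i j hne 1 one_pos hn _ _ (hs i) (hs j)
      ⟨(hs0 i).trans (hs0 j).symm, congrArg Fin.val hij⟩
  simpa using Fintype.card_le_of_injective next hinj

theorem IsCircFlorentine.le_Fc {n m : ℕ} (hn : 1 < n) {β : Fin m → ℕ → ℕ}
    (h : IsCircFlorentine n m β) : m ≤ Fc n :=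
  le_csSup ⟨n, fun _ ⟨_, hγ⟩ => hγ.le hn⟩ ⟨β, h⟩

theorem bijOn_mul_mod_of_coprime {n a : ℕ} (ha : n.Coprime a) :
    Set.BijOn (fun t => a * t % n) (Set.Iio n) (Set.Iio n) := by
  have hmaps : Set.MapsTo (fun t => a * t % n) (Set.Iio n) (Set.Iio n) := fun t ht =>
    Nat.mod_lt _ (Nat.zero_lt_of_lt ht)
  have hinj : Set.InjOn (fun t => a * t % n) (Set.Iio n) := fun s hs t ht hst =>
    (Nat.ModEq.cancel_left_of_coprime ha hst).eq_of_lt_of_lt hs ht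
  exact ((Set.finite_Iio n).injOn_iff_bijOn_of_mapsTo hmaps).1 hinj

theorem isCircFlorentine_mul_mod {p : ℕ} (hp : p.Prime) :
    IsCircFlorentine p (p - 1) (fun a t => (((a : ℕ) + 1) * t) % p) := by
  refine ⟨fun k => bijOn_mul_mod_of_coprime ?_, ?_⟩
  · exact Nat.coprime_of_lt_prime k.val.succ_ne_zero (by omega) hp
  rintro i j hij l hl hlp s s' - - ⟨h, h'⟩
  have hshift : (i + 1) * (s + l) ≡ (j + 1) * (s' + l) [MOD p] :=
    ((Nat.mod_modEq _ p).mul_left _).symm.trans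
      (Nat.ModEq.trans h' ((Nat.mod_modEq _ p).mul_left _))
  rw [mul_add, mul_add] at hshift
  have hmul : (i + 1 : ℕ) * l ≡ (j + 1) * l [MOD p] := Nat.ModEq.add_left_cancel h hshift
  have hcop : p.Coprime l := Nat.coprime_of_lt_prime hl.ne' hlp hp
  have := (Nat.ModEq.cancel_right_of_coprime hcop hmul).eq_of_lt_of_lt (by omega) (by omega)
  exact hij (Fin.ext (Nat.succ_injective this))

/-- For a prime `p`, the permutations `β_a(t) = a·t mod p` for `1 ≤ a ≤ p-1`
(row indexed by `a`, here `a = ↑i + 1` for `i : Fin (p-1)`) form a `(p-1) × p`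
circular Florentine array over `Z_p`; in particular `F_c(p) ≥ p - 1`. -/
theorem circFlorentine_of_prime (p : ℕ) (hp : p.Prime) :
    IsCircFlorentine p (p - 1) (fun a t => (((a : ℕ) + 1) * t) % p) ∧
    p - 1 ≤ Fc p := by
  exact ⟨isCircFlorentine_mul_mod hp, (isCircFlorentine_mul_mod hp).le_Fc hp.one_lt⟩
end
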